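/- arXiv:2007.11242 — 12 statements merged into one kernel-verified Lean document; each statement's English description precedes it below -/
import Mathlib

section
/- Let d ≥ 1, let φ : ℝ^d → ℝ^d be a linear map, let Ξ ⊆ ℝ^d be relatively dense with 0 ∈ Ξ, and suppose there exists an integer M ≥ 1 with φ^M(Ξ) − φ^M(Ξ) ⊆ Ξ (the algebraic coincidence condition, equivalent to pure discrete spectrum for the substitution tilings considered in the paper). Let E ⊆ ℝ^d be a set with Ξ ⊆ E such that E − E is uniformly discrete and E is contained in the additive subgroup of ℝ^d generated by Ξ. Then there exists K ∈ ℕ such that φ^K(E) ⊆ Ξ. -/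
open Pointwise
/-- A uniformly discrete subset of a proper metric space has finite intersection with every ball. -/
theorem finite_inter_ball_of_pairwise_le_dist {X : Type*} [PseudoMetricSpace X] [ProperSpace X]
    {S : Set X} {r : ℝ} (hr : 0 < r) (hS : S.Pairwise fun x y => r ≤ dist x y) (c : X) (R : ℝ) :
    (S ∩ Metric.ball c R).Finite := by
  obtain ⟨t, ht, hcover⟩ := Metric.totallyBounded_iff.1
    ((isCompact_closedBall c R).totallyBounded.subset Metric.ball_subset_closedBall)
    (r / 2) (half_pos hr)
  refine (ht.biUnion (t := fun y => S ∩ Metric.ball y (r / 2)) fun y _ =>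
    Set.Subsingleton.finite ?_).subset fun x hx => ?_
  · rintro a ⟨haS, hay⟩ b ⟨hbS, hby⟩
    by_contra hab
    have := hS haS hbS hab
    have := dist_triangle_right a b y
    rw [Metric.mem_ball] at hay hby
    linarith
  · obtain ⟨y, hy, hxy⟩ := Set.mem_iUnion₂.1 (hcover hx.2)
    exact Set.mem_iUnion₂.2 ⟨y, hy, hx.1, hxy⟩

section AlgebraicCoincidence

variable {R V : Type*} [Ring R] [AddCommGroup V] [Module R V] {f : Module.End R V} {S : Set V}

theorem pow_apply_mem_of_le (hf : ∀ x ∈ S, f x ∈ S) {m n : ℕ} (hmn : m ≤ n) {x : V}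
    (hx : (f ^ m) x ∈ S) : (f ^ n) x ∈ S := by
  induction n, hmn using Nat.le_induction with
  | base => exact hx
  | succ n _ ih =>
    rw [pow_succ', Module.End.mul_apply]
    exact hf _ ih

/-- If `f S - f S ⊆ S`, then every element of the subgroup generated by `S` is eventually
mapped into `S` by the iterates of `f`. -/
theorem exists_pow_apply_mem_of_mem_closure (h0 : 0 ∈ S) (hf : ∀ x ∈ S, ∀ y ∈ S, f x - f y ∈ S)
    {x : V} (hx : x ∈ AddSubgroup.closure S) : ∃ n : ℕ, (f ^ n) x ∈ S := by
  have hfS : ∀ x ∈ S, f x ∈ S := fun x hx => by simpa using hf x hx 0 h0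
  have hneg : ∀ x ∈ S, -f x ∈ S := fun x hx => by simpa using hf 0 h0 x hx
  induction hx using AddSubgroup.closure_induction with
  | mem x hx => exact ⟨0, by simpa using hx⟩
  | zero => exact ⟨0, by simpa using h0⟩
  | add x y _ _ ihx ihy =>
    obtain ⟨m, hm⟩ := ihx
    obtain ⟨n, hn⟩ := ihy
    have hx := hfS _ (pow_apply_mem_of_le hfS (le_max_left m n) hm)
    have hy := hneg _ (pow_apply_mem_of_le hfS (le_max_right m n) hn)
    exact ⟨max m n + 2, by simpa [pow_succ'] using hf _ hx _ hy⟩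
  | neg x _ ih =>
    obtain ⟨n, hn⟩ := ih
    exact ⟨n + 1, by simpa [pow_succ'] using hneg _ hn⟩

theorem exists_pow_apply_mem_of_finite (h0 : 0 ∈ S) (hf : ∀ x ∈ S, ∀ y ∈ S, f x - f y ∈ S)
    {F : Set V} (hF : F.Finite) (hFS : F ⊆ AddSubgroup.closure S) :
    ∃ n : ℕ, ∀ x ∈ F, (f ^ n) x ∈ S := by
  choose! N hN using fun x (hx : x ∈ F) => exists_pow_apply_mem_of_mem_closure h0 hf (hFS hx)
  obtain ⟨n, hn⟩ := (hF.image N).bddAbove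
  exact ⟨n, fun x hx => pow_apply_mem_of_le (fun x hx => by simpa using hf x hx 0 h0)
    (hn (Set.mem_image_of_mem N hx)) (hN x hx)⟩

end AlgebraicCoincidence

/-- If a relatively dense set `Ξ` containing `0` satisfies the algebraic
coincidence condition `φ^M Ξ - φ^M Ξ ⊆ Ξ`, and `E ⊇ Ξ` has uniformly discrete difference
set and is contained in the subgroup generated by `Ξ`, then `φ^K E ⊆ Ξ` for some `K`. -/
theorem stmt_0 (d : ℕ) (hd : 1 ≤ d)
    (φ : Module.End ℝ (EuclideanSpace ℝ (Fin d)))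
    (Ξ E : Set (EuclideanSpace ℝ (Fin d)))
    (hΞrd : ∃ R > (0 : ℝ), ∀ x : EuclideanSpace ℝ (Fin d), ∃ y ∈ Ξ, ‖x - y‖ < R)
    (h0 : (0 : EuclideanSpace ℝ (Fin d)) ∈ Ξ)
    (hM : ∃ M : ℕ, 1 ≤ M ∧ ⇑(φ ^ M) '' Ξ - ⇑(φ ^ M) '' Ξ ⊆ Ξ)
    (hΞE : Ξ ⊆ E)
    (hud : ∃ r > (0 : ℝ), ∀ x ∈ E - E, ∀ y ∈ E - E, x ≠ y → r ≤ ‖x - y‖)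
    (hEL : E ⊆ (AddSubgroup.closure Ξ : AddSubgroup (EuclideanSpace ℝ (Fin d)))) :
    ∃ K : ℕ, ⇑(φ ^ K) '' E ⊆ Ξ := by
  obtain ⟨R, -, hR⟩ := hΞrd
  obtain ⟨M, -, hM⟩ := hM
  obtain ⟨r, hr, hud⟩ := hud
  have hf : ∀ x ∈ Ξ, ∀ y ∈ Ξ, (φ ^ M) x - (φ ^ M) y ∈ Ξ := fun x hx y hy =>
    hM (Set.sub_mem_sub (Set.mem_image_of_mem _ hx) (Set.mem_image_of_mem _ hy))
  have hfin : ((E - E) ∩ Metric.ball 0 R).Finite :=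
    finite_inter_ball_of_pairwise_le_dist hr
      (fun x hx y hy hxy => by simpa only [dist_eq_norm] using hud x hx y hy hxy) 0 R
  have hsub : (E - E) ∩ Metric.ball 0 R ⊆ AddSubgroup.closure Ξ := by
    rintro _ ⟨⟨a, ha, b, hb, rfl⟩, -⟩
    exact sub_mem (hEL ha) (hEL hb)
  obtain ⟨n, hn⟩ := exists_pow_apply_mem_of_finite h0 hf hfin hsub
  refine ⟨M * (n + 2), ?_⟩
  rintro _ ⟨e, he, rfl⟩
  obtain ⟨y, hy, hey⟩ := hR e
  have hdiff := hn (e - y) ⟨Set.sub_mem_sub he (hΞE hy), by simpa using hey⟩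
  have hy' : ((φ ^ M) ^ n) y ∈ Ξ :=
    pow_apply_mem_of_le (m := 0) (fun x hx => by simpa using hf x hx 0 h0) n.zero_le hy
  have key := hf _ (hf _ hy' 0 h0) _ (hf 0 h0 _ hdiff)
  rw [pow_mul, pow_succ', pow_succ', Module.End.mul_apply, Module.End.mul_apply]
  convert key using 1
  simp only [map_sub, map_zero]
  abel
end

section
/- Let L be an additive subgroup of ℝ^d, let φ : ℝ^d → ℝ^d be a linear automorphism with φ(L) = L, let Ψ : L → ℝ^e be an additive group homomorphism, and let D : ℝ^e → ℝ^e be an injective linear map with Ψ(φ(x)) = D(Ψ(x)) for all x ∈ L and ‖D(u)‖ ≤ c‖u‖ for all u ∈ ℝ^e, where 0 < c < 1. Fix δ > 0 and set E_δ = {x ∈ L : ‖Ψ(x)‖ < δ}. Let C ⊆ L be a set such that Ψ(C) is bounded and such that for every z ∈ C there exists N_z ∈ ℕ with z + φ^{N_z}(E_δ) ⊆ C. Then the set U = ⋃_{z ∈ C} (Ψ(z) + D^{N_z}(B_δ(0))) is an open bounded subset of ℝ^e and C = {x ∈ L : Ψ(x) ∈ U}, i.e. C is cut out from L by the window U. 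-/
open Pointwise

theorem norm_pow_apply_le_of_norm_apply_le {E : Type*} [SeminormedAddCommGroup E] [Module ℝ E]
    {D : Module.End ℝ E} (hD : ∀ u, ‖D u‖ ≤ ‖u‖) (n : ℕ) (u : E) : ‖(D ^ n) u‖ ≤ ‖u‖ := by
  induction n with
  | zero => simp
  | succ n ih =>
    rw [pow_succ', Module.End.mul_apply]
    exact (hD _).trans ih

theorem isOpenMap_pow_of_injective {E : Type*} [NormedAddCommGroup E] [NormedSpace ℝ E]
    [FiniteDimensional ℝ E] {D : Module.End ℝ E} (hD : Function.Injective D) (n : ℕ) :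
    IsOpenMap (D ^ n) := by
  refine LinearMap.isOpenMap_of_finiteDimensional _ (LinearMap.injective_iff_surjective.1 ?_)
  rw [Module.End.coe_pow]
  exact hD.iterate n

theorem apply_pow_of_intertwining {V W : Type*} [AddCommGroup V] [Module ℝ V]
    [AddCommGroup W] [Module ℝ W] {L : Set V} {φ : V ≃ₗ[ℝ] V} (hφ : φ '' L = L)
    {Ψ : V → W} {D : Module.End ℝ W} (hcomm : ∀ x ∈ L, Ψ (φ x) = D (Ψ x)) (n : ℕ) :
    ∀ x ∈ L, Ψ ((φ ^ n) x) = (D ^ n) (Ψ x) := by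
  induction n with
  | zero => simp
  | succ n ih =>
    intro x hx
    rw [pow_succ, pow_succ, LinearEquiv.mul_apply, Module.End.mul_apply, ← hcomm x hx]
    exact ih _ (hφ ▸ Set.mem_image_of_mem φ hx)

theorem exists_pow_apply_eq_of_image_eq {V : Type*} [AddCommGroup V] [Module ℝ V] {L : Set V}
    {φ : V ≃ₗ[ℝ] V} (hφ : φ '' L = L) (n : ℕ) : ∀ x ∈ L, ∃ y ∈ L, (φ ^ n) y = x := by
  induction n with
  | zero => exact fun x hx => ⟨x, hx, by simp⟩
  | succ n ih =>
    intro x hx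
    obtain ⟨y, hy, rfl⟩ := ih x hx
    obtain ⟨w, hw, rfl⟩ := hφ.symm ▸ hy
    exact ⟨w, hw, by rw [pow_succ, LinearEquiv.mul_apply]⟩

/-- the window `U = ⋃_{z ∈ C} (Ψ z + D^{N_z}(B_δ(0)))` is open and bounded,
and cuts out `C` from `L`. -/
theorem stmt_1 (d e : ℕ)
    (L : AddSubgroup (EuclideanSpace ℝ (Fin d)))
    (φ : EuclideanSpace ℝ (Fin d) ≃ₗ[ℝ] EuclideanSpace ℝ (Fin d))
    (hφL : ⇑φ '' (L : Set (EuclideanSpace ℝ (Fin d))) = (L : Set (EuclideanSpace ℝ (Fin d))))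
    (Ψ : EuclideanSpace ℝ (Fin d) → EuclideanSpace ℝ (Fin e))
    (hΨ : ∀ x ∈ L, ∀ y ∈ L, Ψ (x + y) = Ψ x + Ψ y)
    (D : Module.End ℝ (EuclideanSpace ℝ (Fin e)))
    (hDinj : Function.Injective D)
    (hcomm : ∀ x ∈ L, Ψ (φ x) = D (Ψ x))
    (c : ℝ) (hc0 : 0 < c) (hc1 : c < 1)
    (hDc : ∀ u, ‖D u‖ ≤ c * ‖u‖)
    (δ : ℝ) (hδ : 0 < δ)
    (C : Set (EuclideanSpace ℝ (Fin d)))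
    (hCL : C ⊆ (L : Set (EuclideanSpace ℝ (Fin d))))
    (hCbdd : ∃ R : ℝ, ∀ z ∈ C, ‖Ψ z‖ ≤ R)
    (N : EuclideanSpace ℝ (Fin d) → ℕ)
    (hN : ∀ z ∈ C, (fun w => z + w) '' (⇑(φ ^ N z) '' {x | x ∈ L ∧ ‖Ψ x‖ < δ}) ⊆ C) :
    IsOpen (⋃ z ∈ C, (fun u => Ψ z + u) '' (⇑(D ^ N z) '' Metric.ball 0 δ)) ∧
    Bornology.IsBounded (⋃ z ∈ C, (fun u => Ψ z + u) '' (⇑(D ^ N z) '' Metric.ball 0 δ)) ∧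
    C = {x | x ∈ L ∧ Ψ x ∈ ⋃ z ∈ C, (fun u => Ψ z + u) '' (⇑(D ^ N z) '' Metric.ball 0 δ)} := by
  refine ⟨?_, ?_, ?_⟩
  · refine isOpen_biUnion fun z _ => ?_
    exact (isOpenMap_add_left (Ψ z)) _ (isOpenMap_pow_of_injective hDinj _ _ Metric.isOpen_ball)
  · obtain ⟨R, hR⟩ := hCbdd
    refine isBounded_iff_forall_norm_le.2 ⟨R + δ, fun v hv => ?_⟩
    simp only [Set.mem_iUnion₂] at hv
    obtain ⟨z, hz, _, ⟨u, hu, rfl⟩, rfl⟩ := hv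
    have hD (u) : ‖D u‖ ≤ ‖u‖ := (hDc u).trans (mul_le_of_le_one_left (norm_nonneg u) hc1.le)
    refine norm_add_le_of_le (hR z hz) ?_
    exact (norm_pow_apply_le_of_norm_apply_le hD _ u).trans (mem_ball_zero_iff.1 hu).le
  · refine Set.Subset.antisymm (fun z hz => ⟨hCL hz, ?_⟩) ?_
    · exact Set.mem_biUnion hz ⟨0, ⟨0, Metric.mem_ball_self hδ, map_zero _⟩, add_zero _⟩
    · rintro x ⟨hx, hxU⟩
      simp only [Set.mem_iUnion₂] at hxU
      obtain ⟨z, hz, _, ⟨u, hu, rfl⟩, hxz⟩ := hxU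
      obtain ⟨y, hy, hyx⟩ := exists_pow_apply_eq_of_image_eq hφL (N z) (x - z)
        (L.sub_mem hx (hCL hz))
      have hΨy : Ψ y = u := by
        have hinj : Function.Injective (D ^ N z) := by
          rw [Module.End.coe_pow]
          exact hDinj.iterate _
        apply hinj
        rw [← apply_pow_of_intertwining hφL hcomm _ y hy, hyx]
        have h := hΨ z (hCL hz) (x - z) (L.sub_mem hx (hCL hz))
        rw [add_sub_cancel, ← hxz] at h
        exact (add_left_cancel h).symm
      refine hN z hz ⟨x - z, ⟨y, ⟨hy, ?_⟩, hyx⟩, add_sub_cancel z x⟩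
      rw [hΨy]
      exact mem_ball_zero_iff.1 hu
end

section
/- Let κ ≥ 1, let B be a κ × κ real matrix with nonnegative entries which is primitive, i.e. there exists r ≥ 1 such that every entry of B^r is strictly positive. Let λ > 0 and let u ∈ ℝ^κ be a vector with all entries strictly positive such that uᵀB = λuᵀ (u is a positive left eigenvector). Let S be a κ × κ real matrix with 0 ≤ S ≤ B entrywise and S ≠ B. If v ∈ ℝ^κ satisfies v ≥ 0 entrywise and λv ≤ Sv entrywise, then v = 0. -/
open Matrix

namespace Matrix

variable {n : Type*} [Fintype n]

/-- A vector `v` with `c • v ≤ B *ᵥ v` is an eigenvector of `B` for `c` as soon as `B` has a positive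
left eigenvector for `c`. -/
theorem mulVec_eq_smul_of_pos_left_eigenvector {B : Matrix n n ℝ} {c : ℝ} {u v : n → ℝ}
    (hu : ∀ i, 0 < u i) (huB : u ᵥ* B = c • u) (h : ∀ i, c * v i ≤ (B *ᵥ v) i) :
    B *ᵥ v = c • v := by
  have hsum : ∑ i, u i * (c * v i) = ∑ i, u i * (B *ᵥ v) i := by
    have huv : u ⬝ᵥ (c • v) = u ⬝ᵥ B *ᵥ v := by
      rw [dotProduct_mulVec, huB, smul_dotProduct, dotProduct_smul]
    simpa [dotProduct] using huv
  have heq := (Finset.sum_eq_sum_iff_of_le fun i _ =>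
    mul_le_mul_of_nonneg_left (h i) (hu i).le).1 hsum
  ext i
  exact (mul_left_cancel₀ (hu i).ne' (heq i (Finset.mem_univ i))).symm

theorem pow_mulVec_eq_smul [DecidableEq n] {R : Type*} [CommSemiring R] {B : Matrix n n R} {c : R}
    {v : n → R} (h : B *ᵥ v = c • v) (r : ℕ) : (B ^ r) *ᵥ v = c ^ r • v := by
  induction r with
  | zero => simp
  | succ r ih => rw [pow_succ, ← mulVec_mulVec, h, mulVec_smul, ih, smul_smul, pow_succ']

/-- A positive matrix maps nonzero nonnegative vectors to positive vectors. -/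
theorem mulVec_pos_of_pos {A : Matrix n n ℝ} {v : n → ℝ} (hA : ∀ i j, 0 < A i j)
    (hv : ∀ i, 0 ≤ v i) (hne : v ≠ 0) (i : n) : 0 < (A *ᵥ v) i := by
  obtain ⟨j, hj⟩ := Function.ne_iff.1 hne
  exact Finset.sum_pos' (fun k _ => mul_nonneg (hA i k).le (hv k))
    ⟨j, Finset.mem_univ j, mul_pos (hA i j) ((hv j).lt_of_ne' hj)⟩

/-- Entrywise comparable matrices that agree on a positive vector are equal. -/
theorem eq_of_le_of_mulVec_eq {S B : Matrix n n ℝ} {v : n → ℝ} (hSB : ∀ i j, S i j ≤ B i j)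
    (hv : ∀ i, 0 < v i) (h : S *ᵥ v = B *ᵥ v) : S = B := by
  ext i j
  have heq := (Finset.sum_eq_sum_iff_of_le fun k _ =>
    mul_le_mul_of_nonneg_right (hSB i k) (hv k).le).1 (congrFun h i)
  exact mul_right_cancel₀ (hv j).ne' (heq j (Finset.mem_univ j))

end Matrix

/-- if `B` is a primitive nonnegative matrix with positive left
eigenvector `u` for the eigenvalue `lam`, `0 ≤ S ≤ B` entrywise with `S ≠ B`,
and `v ≥ 0` satisfies `lam • v ≤ S v` entrywise, then `v = 0`. -/
theorem stmt_2 (κ : ℕ) (hκ : 1 ≤ κ)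
    (B : Matrix (Fin κ) (Fin κ) ℝ)
    (hBnn : ∀ i j, 0 ≤ B i j)
    (hprim : ∃ r : ℕ, 1 ≤ r ∧ ∀ i j, 0 < (B ^ r) i j)
    (lam : ℝ) (hlam : 0 < lam)
    (u : Fin κ → ℝ) (hu : ∀ i, 0 < u i)
    (huB : Matrix.vecMul u B = lam • u)
    (S : Matrix (Fin κ) (Fin κ) ℝ)
    (hS0 : ∀ i j, 0 ≤ S i j) (hSB : ∀ i j, S i j ≤ B i j) (hSne : S ≠ B)
    (v : Fin κ → ℝ) (hv : ∀ i, 0 ≤ v i)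
    (hSv : ∀ i, lam * v i ≤ Matrix.mulVec S v i) :
    v = 0 := by
  by_contra hne
  have hle (i : Fin κ) : (S *ᵥ v) i ≤ (B *ᵥ v) i :=
    dotProduct_le_dotProduct_of_nonneg_right (hSB i) hv
  have hBv : B *ᵥ v = lam • v :=
    mulVec_eq_smul_of_pos_left_eigenvector hu huB fun i => (hSv i).trans (hle i)
  obtain ⟨r, -, hr⟩ := hprim
  have hvpos (i : Fin κ) : 0 < v i := by
    have hi := mulVec_pos_of_pos hr hv hne i
    rw [pow_mulVec_eq_smul hBv r] at hi
    exact pos_of_mul_pos_right hi (pow_nonneg hlam.le r)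
  refine hSne (eq_of_le_of_mulVec_eq hSB hvpos (funext fun i => (hle i).antisymm ?_))
  rw [hBv]
  exact hSv i
end

section
/- Let φ : ℝ^d → ℝ^d be a linear map and let Ξ ⊆ ℝ^d be a set with 0 ∈ Ξ such that φ^M(Ξ) − φ^M(Ξ) ⊆ Ξ for some integer M ≥ 1. Then for every element y of the additive subgroup of ℝ^d generated by Ξ there exists ℓ ∈ ℕ (depending on y) such that φ^ℓ(y) ∈ Ξ. -/
open Pointwise

/-- If `0 ∈ S` and `ψ S - ψ S ⊆ S`, then every element of the additive subgroup generated by `S`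
is eventually mapped into `S` by the iterates of `ψ`. -/
theorem exists_pow_apply_mem_of_mem_closure_s4 {R V : Type*} [Ring R] [AddCommGroup V] [Module R V]
    (ψ : Module.End R V) (S : Set V) (h0 : (0 : V) ∈ S) (hsub : ⇑ψ '' S - ⇑ψ '' S ⊆ S)
    {y : V} (hy : y ∈ AddSubgroup.closure S) : ∃ k : ℕ, (ψ ^ k) y ∈ S := by
  have hdiff {u v : V} (hu : u ∈ S) (hv : v ∈ S) : ψ u - ψ v ∈ S :=
    hsub (Set.sub_mem_sub (Set.mem_image_of_mem ψ hu) (Set.mem_image_of_mem ψ hv))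
  have hmap {u : V} (hu : u ∈ S) : ψ u ∈ S := by simpa using hdiff hu h0
  have hneg {u : V} (hu : u ∈ S) : -ψ u ∈ S := by simpa using hdiff h0 hu
  have hpow {u : V} (hu : u ∈ S) (n : ℕ) : (ψ ^ n) u ∈ S := by
    induction n with
    | zero => simpa using hu
    | succ n ih => simpa only [pow_succ', Module.End.mul_apply] using hmap ih
  induction hy using AddSubgroup.closure_induction with
  | mem x hx => exact ⟨0, by simpa using hx⟩
  | zero => exact ⟨0, by simpa using h0⟩
  | add x y _ _ hx hy =>
    obtain ⟨a, ha⟩ := hx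
    obtain ⟨b, hb⟩ := hy
    have hx' : (ψ ^ (a + b)) x ∈ S := by
      simpa only [add_comm a b, pow_add, Module.End.mul_apply] using hpow ha b
    have hy' : (ψ ^ (a + b)) y ∈ S := by
      simpa only [pow_add, Module.End.mul_apply] using hpow hb a
    refine ⟨a + b + 1 + 1, ?_⟩
    simpa [pow_succ'] using hdiff (hmap hx') (hneg hy')
  | neg x _ hx =>
    obtain ⟨a, ha⟩ := hx
    exact ⟨a + 1, by simpa [pow_succ'] using hneg ha⟩

/-- if `0 ∈ Ξ` and `φ^M Ξ - φ^M Ξ ⊆ Ξ` for some `M ≥ 1`, then every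
element `y` of the additive subgroup generated by `Ξ` satisfies `φ^ℓ y ∈ Ξ` for some `ℓ`. -/
theorem stmt_4 (d : ℕ)
    (φ : Module.End ℝ (EuclideanSpace ℝ (Fin d)))
    (Ξ : Set (EuclideanSpace ℝ (Fin d)))
    (h0 : (0 : EuclideanSpace ℝ (Fin d)) ∈ Ξ)
    (M : ℕ) (hM : 1 ≤ M)
    (hsub : ⇑(φ ^ M) '' Ξ - ⇑(φ ^ M) '' Ξ ⊆ Ξ) :
    ∀ y ∈ AddSubgroup.closure Ξ, ∃ ℓ : ℕ, (φ ^ ℓ) y ∈ Ξ := by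
  intro y hy
  obtain ⟨k, hk⟩ := exists_pow_apply_mem_of_mem_closure_s4 (φ ^ M) Ξ h0 hsub hy
  exact ⟨M * k, by rwa [pow_mul]⟩
end

section
/- Let E ⊆ ℝ^d be a set such that E − E is uniformly discrete, and let Ξ ⊆ E be relatively dense in ℝ^d. Then there exists a finite set F ⊆ ℝ^d such that E ⊆ Ξ − F, i.e. every x ∈ E satisfies x ∈ Ξ − v for some v ∈ F; moreover F can be taken to be (Ξ − E) ∩ B_r(0) for a suitable r > 0, and this set is finite. -/
open Pointwise

/-- A bounded subset of a proper metric space whose distinct points are at least `s` apart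
is finite. -/
theorem Bornology.IsBounded.finite_of_pairwise_le_dist {X : Type*} [PseudoMetricSpace X]
    [ProperSpace X] {A : Set X} (hA : Bornology.IsBounded A) {s : ℝ} (hs : 0 < s)
    (hsep : A.Pairwise fun x y => s ≤ dist x y) : A.Finite := by
  obtain ⟨t, ht, hAt⟩ := Metric.totallyBounded_iff.1
    (hA.isCompact_closure.totallyBounded.subset subset_closure) (s / 2) (half_pos hs)
  have hcover : ∀ x ∈ A, ∃ c ∈ t, dist x c < s / 2 := fun x hx => by
    simpa using hAt hx
  choose! f hft hf using hcover
  refine Set.Finite.of_injOn hft (fun x hx y hy hxy => ?_) ht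
  by_contra hne
  have hx' := hf x hx
  rw [hxy] at hx'
  linarith [hsep hx hy hne, dist_triangle_right x y (f y), hf y hy]

/-- if `E - E` is uniformly discrete and `Ξ ⊆ E` is relatively dense,
then `F = (Ξ - E) ∩ B_r(0)` is finite for a suitable `r > 0` and `E ⊆ Ξ - F`. -/
theorem stmt_6 (d : ℕ)
    (E Ξ : Set (EuclideanSpace ℝ (Fin d)))
    (hud : ∃ r > (0 : ℝ), ∀ x ∈ E - E, ∀ y ∈ E - E, x ≠ y → r ≤ ‖x - y‖)
    (hΞE : Ξ ⊆ E)
    (hrd : ∃ R > (0 : ℝ), ∀ x : EuclideanSpace ℝ (Fin d), ∃ y ∈ Ξ, ‖x - y‖ < R) :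
    ∃ r > (0 : ℝ), ((Ξ - E) ∩ Metric.ball 0 r).Finite ∧
      E ⊆ Ξ - ((Ξ - E) ∩ Metric.ball 0 r) := by
  obtain ⟨s, hs, hsep⟩ := hud
  obtain ⟨R, hR, hdense⟩ := hrd
  refine ⟨R, hR, ?_, fun x hx => ?_⟩
  · refine (Metric.isBounded_ball.subset Set.inter_subset_right).finite_of_pairwise_le_dist hs
      fun x hx y hy hne => ?_
    have hsub : Ξ - E ⊆ E - E := Set.sub_subset_sub_right hΞE
    change s ≤ dist x y
    rw [dist_eq_norm]
    exact hsep x (hsub hx.1) y (hsub hy.1) hne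
  · obtain ⟨y, hy, hxy⟩ := hdense x
    refine ⟨y, hy, y - x, ⟨Set.sub_mem_sub hy hx, ?_⟩, sub_sub_cancel y x⟩
    rwa [mem_ball_zero_iff, norm_sub_rev]
end

section
/- Let p ∈ ℤ[X] be a monic polynomial of degree n ≥ 2 that is irreducible over ℚ and whose roots λ_1, …, λ_n are all real (and necessarily distinct), and let 1 ≤ m < n. Consider L̃ := {(g(λ_1), …, g(λ_n)) : g ∈ ℤ[X]} ⊆ ℝ^n = ℝ^m × ℝ^{n−m}. Then: (i) L̃ is a lattice in ℝ^n, i.e. a discrete additive subgroup with compact quotient ℝ^n/L̃; (ii) the projection π_1 onto the first m coordinates is injective on L̃; (iii) the projection π_2 of L̃ onto the last n − m coordinates has dense image in ℝ^{n−m}. Hence (ℝ^m, ℝ^{n−m}, L̃) is a cut-and-project scheme with Euclidean internal space ℝ^{n−m}. -/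
open Polynomial Submodule Module

/-- Over a common irreducible monic polynomial, an integer polynomial vanishing at one root vanishes
at every root. -/
theorem aeval_eq_zero_of_irreducible_of_root {p : ℤ[X]} (hmonic : p.Monic)
    (hirr : Irreducible (p.map (Int.castRingHom ℚ))) {x y : ℝ} (hx : aeval x p = 0)
    (hy : aeval y p = 0) {g : ℤ[X]} (hg : aeval x g = 0) : aeval y g = 0 := by
  have key (z : ℝ) (q : ℤ[X]) : aeval z (q.map (Int.castRingHom ℚ)) = aeval z q :=
    aeval_map_algebraMap (A := ℚ) z q
  have hmin : p.map (Int.castRingHom ℚ) = minpoly ℚ x :=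
    minpoly.eq_of_irreducible_of_monic hirr (by rw [key, hx]) (hmonic.map _)
  have hdvd : minpoly ℚ x ∣ g.map (Int.castRingHom ℚ) := minpoly.dvd ℚ x (by rw [key, hg])
  rw [← hmin] at hdvd
  obtain ⟨r, hr⟩ := hdvd
  rw [← key, hr, map_mul, key, hy, zero_mul]

/-- The integer span of a `ℤ`-linearly independent family with more members than the real dimension
of the ambient space contains arbitrarily short nonzero vectors. -/
theorem exists_mem_span_int_ne_zero_norm_lt {ι E : Type*} [Fintype ι] [NormedAddCommGroup E]
    [NormedSpace ℝ E] [FiniteDimensional ℝ E] {b : ι → E} (hb : LinearIndependent ℤ b)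
    (hcard : finrank ℝ E < Fintype.card ι) {ε : ℝ} (hε : 0 < ε) :
    ∃ x ∈ span ℤ (Set.range b), x ≠ 0 ∧ ‖x‖ < ε := by
  by_contra! h
  have hdisc : DiscreteTopology (span ℤ (Set.range b)) := by
    refine discreteTopology_iff_isOpen_singleton_zero.mpr
      ⟨Metric.ball 0 ε, Metric.isOpen_ball, ?_⟩
    ext x
    rw [Set.mem_preimage, mem_ball_zero_iff, Set.mem_singleton_iff]
    refine ⟨fun hx => ?_, fun hx => by simpa [hx] using hε⟩
    by_contra hne
    exact (h x x.2 (by simpa using hne)).not_gt hx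
  have h1 := Real.finrank_eq_int_finrank_of_discrete hdisc
  have h2 : Set.finrank ℤ (Set.range b) = Fintype.card ι := finrank_span_eq_card hb
  have h3 : Set.finrank ℝ (Set.range b) ≤ finrank ℝ E := Submodule.finrank_le _
  omega

/-- The quotient of a finite-dimensional real space by the integer span of a basis is compact. -/
theorem ZSpan.compactSpace_quotient {ι E : Type*} [Finite ι] [NormedAddCommGroup E]
    [NormedSpace ℝ E] (b : Basis ι ℝ E) :
    CompactSpace (E ⧸ (span ℤ (Set.range b)).toAddSubgroup) := by
  cases nonempty_fintype ι
  have : FiniteDimensional ℝ E := b.finiteDimensional_of_finite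
  have : ProperSpace E := FiniteDimensional.proper ℝ E
  refine ⟨?_⟩
  have hc := (isCompact_closedBall (0 : E) (∑ i, ‖b i‖)).image
    (QuotientAddGroup.continuous_mk (N := (span ℤ (Set.range b)).toAddSubgroup))
  convert hc
  refine (Set.eq_univ_of_forall fun q => ?_).symm
  obtain ⟨x, rfl⟩ := QuotientAddGroup.mk_surjective q
  refine ⟨ZSpan.fract b x, by simpa using ZSpan.norm_fract_le b x, ?_⟩
  rw [QuotientAddGroup.eq]
  have : -ZSpan.fract b x + x = ZSpan.floor b x := by simp [ZSpan.fract_apply]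
  rw [this]
  exact (ZSpan.floor b x).2

/-- The basis of `ℝⁿ` whose `j`-th member is the vector of `j`-th powers of distinct reals. -/
noncomputable def powersBasis {n : ℕ} (x : Fin n → ℝ) (hx : Function.Injective x) :
    Basis (Fin n) ℝ (EuclideanSpace ℝ (Fin n)) :=
  (basisOfLinearIndependentOfCardEqFinrank' _
    (Matrix.linearIndependent_cols_of_det_ne_zero (Matrix.det_vandermonde_ne_zero_iff.mpr hx))
    (by simp)).map (WithLp.linearEquiv 2 ℝ (Fin n → ℝ)).symm

theorem powersBasis_apply {n : ℕ} (x : Fin n → ℝ) (hx : Function.Injective x) (j i : Fin n) :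
    powersBasis x hx j i = x i ^ (j : ℕ) := by
  simp [powersBasis, Matrix.vandermonde_apply]

/-- The integer span of the power vectors of the roots of a monic polynomial consists of the value
vectors of integer polynomials. -/
theorem mem_span_powersBasis_iff {n : ℕ} {p : ℤ[X]} (hmonic : p.Monic) (hdeg : p.natDegree = n)
    (hn : n ≠ 0) {x : Fin n → ℝ} (hx : Function.Injective x) (hroot : ∀ i, aeval (x i) p = 0)
    {v : EuclideanSpace ℝ (Fin n)} :
    v ∈ span ℤ (Set.range (powersBasis x hx)) ↔ ∃ g : ℤ[X], ∀ i, v i = aeval (x i) g := by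
  constructor
  · intro hv
    induction hv using Submodule.span_induction with
    | mem v hv =>
      obtain ⟨j, rfl⟩ := hv
      exact ⟨X ^ (j : ℕ), fun i => by simp [powersBasis_apply]⟩
    | zero => exact ⟨0, by simp⟩
    | add v w _ _ hv hw =>
      obtain ⟨g, hg⟩ := hv
      obtain ⟨h, hh⟩ := hw
      exact ⟨g + h, fun i => by simp [hg, hh]⟩
    | smul c v _ hv =>
      obtain ⟨g, hg⟩ := hv
      exact ⟨c • g, fun i => by simp [hg]⟩
  · rintro ⟨g, hg⟩
    have hlt : (g %ₘ p).natDegree < n :=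
      hdeg ▸ natDegree_modByMonic_lt g hmonic fun h => hn (by rw [← hdeg, h, natDegree_one])
    have hv : v = ∑ j : Fin n, (g %ₘ p).coeff j • powersBasis x hx j := by
      ext i
      rw [hg, ← aeval_modByMonic_eq_self_of_root (hroot i), aeval_eq_sum_range' hlt,
        Finset.sum_range]
      simp [powersBasis_apply]
    rw [hv]
    exact sum_mem fun j _ => smul_mem _ _ (subset_span ⟨j, rfl⟩)


/-- totally real cut-and-project scheme: for a monic irreducible
integer polynomial of degree `n = m + k ≥ 2` with all roots real and distinct, the set
`L̃ = {(g(λ_1), …, g(λ_n)) : g ∈ ℤ[X]}` is a lattice in `ℝ^n`; the projection to the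
first `m` coordinates is injective on `L̃`, and the projection to the last `k = n - m`
coordinates has dense image. -/
theorem stmt_7 (m k : ℕ) (hm : 1 ≤ m) (hk : 1 ≤ k)
    (p : Polynomial ℤ) (hmonic : p.Monic) (hdeg : p.natDegree = m + k)
    (hirr : Irreducible (p.map (Int.castRingHom ℚ)))
    (lam : Fin (m + k) → ℝ) (hinj : Function.Injective lam)
    (hroots : p.map (Int.castRingHom ℝ) = ∏ i, (Polynomial.X - Polynomial.C (lam i))) :
    ∃ Λ : AddSubgroup (EuclideanSpace ℝ (Fin (m + k))),
      (Λ : Set (EuclideanSpace ℝ (Fin (m + k)))) =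
        {v | ∃ g : Polynomial ℤ, ∀ i, v i = Polynomial.aeval (lam i) g} ∧
      DiscreteTopology Λ ∧
      CompactSpace (EuclideanSpace ℝ (Fin (m + k)) ⧸ Λ) ∧
      (∀ v ∈ Λ, ∀ w ∈ Λ, (∀ i : Fin m, v (Fin.castAdd k i) = w (Fin.castAdd k i)) → v = w) ∧
      Dense {w : EuclideanSpace ℝ (Fin k) |
        ∃ v ∈ Λ, ∀ i : Fin k, w i = v (Fin.natAdd m i)} := by
  have hroot (i) : aeval (lam i) p = 0 := by
    have h : (p.map (Int.castRingHom ℝ)).eval (lam i) = 0 := by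
      rw [hroots, eval_prod]
      exact Finset.prod_eq_zero (Finset.mem_univ i) (by simp)
    rwa [eval_map] at h
  have hmem {v} := mem_span_powersBasis_iff (v := v) hmonic hdeg (by omega) hinj hroot
  have hzero {v} (hv : v ∈ span ℤ (Set.range (powersBasis lam hinj))) {i} (hi : v i = 0) :
      v = 0 := by
    obtain ⟨g, hg⟩ := hmem.mp hv
    ext j
    rw [hg]
    exact aeval_eq_zero_of_irreducible_of_root hmonic hirr (hroot i) (hroot j) (hg i ▸ hi)
  refine ⟨(span ℤ (Set.range (powersBasis lam hinj))).toAddSubgroup, ?_, inferInstance,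
    ZSpan.compactSpace_quotient _, fun v hv w hw h => ?_, ?_⟩
  · ext v
    exact hmem
  · refine sub_eq_zero.mp (hzero (sub_mem hv hw) (i := Fin.castAdd k ⟨0, hm⟩) ?_)
    rw [PiLp.sub_apply, h, sub_self]
  · let π : EuclideanSpace ℝ (Fin (m + k)) →ₗ[ℤ] EuclideanSpace ℝ (Fin k) :=
      { toFun v := WithLp.toLp 2 fun i => v (Fin.natAdd m i)
        map_add' _ _ := rfl
        map_smul' c v := by ext i; simp }
    have hπ (v) (i : Fin k) : π v i = v (Fin.natAdd m i) := rfl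
    have hπinj : Set.InjOn π (span ℤ (Set.range (powersBasis lam hinj))) := by
      intro v hv w hw h
      refine sub_eq_zero.mp (hzero (sub_mem hv hw) (i := Fin.natAdd m ⟨0, hk⟩) ?_)
      rw [PiLp.sub_apply, ← hπ, ← hπ, h, sub_self]
    have hli : LinearIndependent ℤ (π ∘ powersBasis lam hinj) :=
      ((powersBasis lam hinj).linearIndependent.restrict_scalars'
        ℤ).map_injOn π hπinj
    set C := ∑ i, ‖powersBasis lam hinj i‖
    have hC : 0 ≤ C := Finset.sum_nonneg fun i _ => norm_nonneg _
    refine Metric.dense_iff.mpr fun y ε hε => ?_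
    obtain ⟨a, ha, ha0, haε⟩ := exists_mem_span_int_ne_zero_norm_lt hli (by simp; omega)
      (ε := ε / (k * (C + 1))) (by positivity)
    rw [Set.range_comp, ← map_span] at ha
    obtain ⟨α, hα, rfl⟩ := ha
    have hα0 (i) : α i ≠ 0 := fun h => ha0 (by rw [hzero hα h, map_zero])
    obtain ⟨g, hg⟩ := hmem.mp hα
    -- Approximate `y / α` within `C` by a lattice vector `v`; then `α * v` approximates `y`.
    let z : EuclideanSpace ℝ (Fin (m + k)) :=
      WithLp.toLp 2 (Fin.append 0 fun i => y i / α (Fin.natAdd m i))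
    obtain ⟨h, hh⟩ := hmem.mp (ZSpan.floor (powersBasis lam hinj) z).2
    let w : EuclideanSpace ℝ (Fin (m + k)) := WithLp.toLp 2 fun i => aeval (lam i) (g * h)
    refine ⟨π w, ?_, w, hmem.mpr ⟨g * h, fun i => rfl⟩, hπ w⟩
    have hcoord (i : Fin k) : ‖(π w - y) i‖ ≤ ‖π α‖ * C := by
      have heq : (y - π w) i =
          π α i * ZSpan.fract (powersBasis lam hinj) z (Fin.natAdd m i) := by
        have hz : z (Fin.natAdd m i) = y i / α (Fin.natAdd m i) :=
          Fin.append_right 0 (fun i => y i / α (Fin.natAdd m i)) i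
        have hw : w (Fin.natAdd m i) = aeval (lam (Fin.natAdd m i)) (g * h) := rfl
        rw [ZSpan.fract_apply, PiLp.sub_apply, PiLp.sub_apply, hπ, hπ, hz, hh, hw, map_mul, ← hg]
        field_simp [hα0 (Fin.natAdd m i)]
      rw [← neg_sub, PiLp.neg_apply, norm_neg, heq, norm_mul]
      exact mul_le_mul (PiLp.norm_apply_le _ _)
        ((PiLp.norm_apply_le _ _).trans (ZSpan.norm_fract_le _ _)) (norm_nonneg _) (norm_nonneg _)
    have hnorm : ‖π w - y‖ ≤ ∑ i, ‖(π w - y) i‖ := by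
      rw [EuclideanSpace.norm_eq]
      refine Real.sqrt_le_iff.mpr ⟨by positivity, ?_⟩
      exact Finset.sum_sq_le_sq_sum_of_nonneg fun i _ => norm_nonneg _
    rw [mem_ball_iff_norm]
    calc ‖π w - y‖ ≤ ∑ i, ‖(π w - y) i‖ := hnorm
      _ ≤ ∑ _i : Fin k, ‖π α‖ * C := Finset.sum_le_sum fun i _ => hcoord i
      _ = ‖π α‖ * (k * C) := by simp; ring
      _ ≤ ‖π α‖ * (k * (C + 1)) := by gcongr; linarith
      _ < ε := (lt_div_iff₀ (by positivity)).mp haε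
end

section
/- Let p ∈ ℤ[X] be a monic polynomial of degree n that is irreducible over ℚ and whose roots λ_1, …, λ_n are all real (and necessarily distinct), and let 1 ≤ m < n. Then the set {(g(λ_{m+1}), …, g(λ_n)) : g ∈ ℤ[X]} is dense in ℝ^{n−m}. -/
open Polynomial in
/-- An integer polynomial vanishing at a root of a monic polynomial irreducible over `ℚ`, and of
smaller degree, is zero. -/
theorem Polynomial.eq_zero_of_aeval_eq_zero_of_degree_lt {p : ℤ[X]} (hmonic : p.Monic)
    (hirr : Irreducible (p.map (Int.castRingHom ℚ))) {x : ℝ} (hx : aeval x p = 0)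
    {q : ℤ[X]} (hq : aeval x q = 0) (hdeg : q.degree < p.degree) : q = 0 := by
  have haeval (r : ℤ[X]) : aeval x (r.map (Int.castRingHom ℚ)) = aeval x r :=
    aeval_map_algebraMap ℚ x r
  have hinj : Function.Injective (Int.castRingHom ℚ) := Int.cast_injective
  have hmin := minpoly.eq_of_irreducible_of_monic hirr (x := x) (by rw [haeval, hx])
    (hmonic.map _)
  by_contra hne
  have hle := minpoly.degree_le_of_ne_zero ℚ x
    (p := q.map (Int.castRingHom ℚ)) ((Polynomial.map_ne_zero_iff hinj).2 hne) (by rw [haeval, hq])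
  rw [← hmin, degree_map_eq_of_injective hinj, degree_map_eq_of_injective hinj] at hle
  exact absurd hdeg (not_lt.2 hle)

open Polynomial in
/-- If `l ∈ ℝᵏ` is a root of no nonzero integer polynomial of degree at most `k`, then such
polynomials take arbitrarily small nonzero values at `l`. -/
theorem Polynomial.exists_aeval_ne_zero_norm_lt {k : ℕ} (l : Fin k → ℝ)
    (h : ∀ q : ℤ[X], q.degree < (k + 1 : ℕ) → aeval l q = 0 → q = 0) {ε : ℝ} (hε : 0 < ε) :
    ∃ q : ℤ[X], q.degree < (k + 1 : ℕ) ∧ aeval l q ≠ 0 ∧ ‖aeval l q‖ < ε := by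
  by_contra! hcon
  let L : Submodule ℤ (Fin k → ℝ) := (degreeLT ℤ (k + 1)).map (aeval (R := ℤ) l).toLinearMap
  have hdisc : DiscreteTopology L := by
    refine DiscreteTopology.of_forall_le_dist hε ?_
    rintro ⟨_, q, hq, rfl⟩ ⟨_, r, hr, rfl⟩ hne
    have hmem := mem_degreeLT.1 (sub_mem hq hr)
    have hsub := hcon (q - r) hmem (by
      rw [map_sub, sub_ne_zero]
      exact fun h' => hne (Subtype.ext h'))
    rw [Subtype.dist_eq, dist_eq_norm]
    simpa using hsub
  have hrank : Module.finrank ℤ L = k + 1 := by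
    have hinj : Function.Injective
        ((aeval (R := ℤ) l).toLinearMap.domRestrict (degreeLT ℤ (k + 1))) := by
      rw [← LinearMap.ker_eq_bot, LinearMap.ker_eq_bot']
      rintro ⟨q, hq⟩ h0
      exact Subtype.ext (h q (mem_degreeLT.1 hq) h0)
    have hfin := LinearMap.finrank_range_of_inj hinj
    rw [LinearMap.range_domRestrict, (degreeLTEquiv ℤ (k + 1)).finrank_eq] at hfin
    simpa using hfin
  have heq := Real.finrank_eq_int_finrank_of_discrete (s := (L : Set (Fin k → ℝ)))
    (by rw [Submodule.span_eq]; exact hdisc)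
  have hle : Set.finrank ℝ (L : Set (Fin k → ℝ)) ≤ k := by
    rw [Set.finrank]
    simpa only [Module.finrank_fin_fun] using
      Submodule.finrank_le (Submodule.span ℝ (L : Set (Fin k → ℝ)))
  rw [heq, Set.finrank, Submodule.span_eq, hrank] at hle
  lia

open Polynomial in
/-- Integer polynomials approximate a multiple `w * v` of `w` with an error proportional to `w`. -/
theorem Polynomial.exists_norm_mul_aeval_sub_le {k : ℕ} (hk : 0 < k) {l : Fin k → ℝ}
    (hl : Function.Injective l) (w v : Fin k → ℝ) :
    ∃ q : ℤ[X], ‖w * aeval l q - w * v‖ ≤ ‖w‖ * ∑ j ∈ Finset.range k, ‖l ^ j‖ := by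
  let f : ℝ[X] := Lagrange.interpolate Finset.univ l v
  have hf : aeval l f = v := by
    ext i
    rw [aeval_pi_apply₂, coe_aeval_eq_eval]
    exact Lagrange.eval_interpolate_at_node v hl.injOn (Finset.mem_univ i)
  have hdeg : f.natDegree < k := by
    rcases eq_or_ne f 0 with h0 | h0
    · rwa [h0, natDegree_zero]
    rw [natDegree_lt_iff_degree_lt h0]
    simpa only [Finset.card_univ, Fintype.card_fin] using
      Lagrange.degree_interpolate_lt (s := Finset.univ) v hl.injOn
  have hv : v = ∑ j ∈ Finset.range k, f.coeff j • l ^ j := by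
    rw [← aeval_eq_sum_range' hdeg, hf]
  refine ⟨∑ j ∈ Finset.range k, C (round (f.coeff j)) * X ^ j, ?_⟩
  rw [← mul_sub]
  refine (norm_mul_le _ _).trans (mul_le_mul_of_nonneg_left ?_ (norm_nonneg w))
  rw [map_sum, hv, ← Finset.sum_sub_distrib]
  refine norm_sum_le_of_le _ fun j _ => ?_
  have hterm : aeval l (C (round (f.coeff j)) * X ^ j) - f.coeff j • l ^ j =
      ((round (f.coeff j) : ℝ) - f.coeff j) • l ^ j := by
    ext i
    simp [sub_mul]
  rw [hterm, norm_smul]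
  refine mul_le_of_le_one_left (norm_nonneg _) ?_
  rw [norm_sub_rev, Real.norm_eq_abs]
  exact (abs_sub_round _).trans (by norm_num)

open Polynomial in
/-- If no nonzero integer polynomial of degree at most `k` vanishes at a coordinate of `l ∈ ℝᵏ`,
then the values at `l` of the integer polynomials are dense in `ℝᵏ`. -/
theorem Polynomial.denseRange_aeval_int {k : ℕ} (hk : 0 < k) {l : Fin k → ℝ}
    (hl : Function.Injective l)
    (h : ∀ i, ∀ q : ℤ[X], q.degree < (k + 1 : ℕ) → aeval (l i) q = 0 → q = 0) :
    DenseRange fun q : ℤ[X] => aeval l q := by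
  intro x
  rw [Metric.mem_closure_range_iff]
  intro ε hε
  set B := ∑ j ∈ Finset.range k, ‖l ^ j‖
  have hB : 0 ≤ B := Finset.sum_nonneg fun _ _ => norm_nonneg _
  obtain ⟨g, hgdeg, hg0, hg⟩ := exists_aeval_ne_zero_norm_lt l
    (fun q hq h0 => h ⟨0, hk⟩ q hq (by rw [← aeval_pi_apply₂, h0, Pi.zero_apply]))
    (div_pos hε (by linarith : 0 < B + 1))
  have hgi (i : Fin k) : aeval l g i ≠ 0 := by
    rw [aeval_pi_apply₂]
    intro h0
    exact hg0 (by rw [h i g hgdeg h0, map_zero])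
  obtain ⟨q, hq⟩ := exists_norm_mul_aeval_sub_le hk hl (aeval l g) (x / aeval l g)
  have hx : aeval l g * (x / aeval l g) = x := by
    ext i
    exact _root_.mul_div_cancel₀ _ (hgi i)
  refine ⟨g * q, ?_⟩
  rw [hx, ← map_mul] at hq
  rw [dist_comm, dist_eq_norm]
  calc ‖aeval l (g * q) - x‖ ≤ ‖aeval l g‖ * B := hq
    _ ≤ ‖aeval l g‖ * (B + 1) := by gcongr; linarith
    _ < ε := (lt_div_iff₀ (by linarith)).1 hg

/-- density lemma, totally real case: for a monic irreducible integer
polynomial of degree `n = m + k` with all roots real and distinct and `1 ≤ m < n`, the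
set `{(g(λ_{m+1}), …, g(λ_n)) : g ∈ ℤ[X]}` is dense in `ℝ^{n-m}`. -/
theorem stmt_9 (m k : ℕ) (hm : 1 ≤ m) (hk : 1 ≤ k)
    (p : Polynomial ℤ) (hmonic : p.Monic) (hdeg : p.natDegree = m + k)
    (hirr : Irreducible (p.map (Int.castRingHom ℚ)))
    (lam : Fin (m + k) → ℝ) (hinj : Function.Injective lam)
    (hroots : p.map (Int.castRingHom ℝ) = ∏ i, (Polynomial.X - Polynomial.C (lam i))) :
    Dense {w : EuclideanSpace ℝ (Fin k) |
      ∃ g : Polynomial ℤ, ∀ i : Fin k, w i = Polynomial.aeval (lam (Fin.natAdd m i)) g} := by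
  have hroot (i : Fin (m + k)) : Polynomial.aeval (lam i) p = 0 := by
    rw [Polynomial.aeval_def, ← Polynomial.eval_map]
    change Polynomial.eval (lam i) (p.map (Int.castRingHom ℝ)) = 0
    rw [hroots, Polynomial.eval_prod]
    exact Finset.prod_eq_zero (Finset.mem_univ i) (by simp)
  have hle : ((k + 1 : ℕ) : WithBot ℕ) ≤ p.degree := by
    rw [Polynomial.degree_eq_natDegree hmonic.ne_zero, hdeg]
    exact_mod_cast (by lia : k + 1 ≤ m + k)
  have hdense := Polynomial.denseRange_aeval_int hk (l := fun i => lam (Fin.natAdd m i))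
    (hinj.comp (Fin.natAdd_injective k m)) fun i q hq h0 =>
      Polynomial.eq_zero_of_aeval_eq_zero_of_degree_lt hmonic hirr (hroot _) h0
        (hq.trans_le hle)
  refine (hdense.preimage (EuclideanSpace.equiv (Fin k) ℝ).toHomeomorph.isOpenMap).mono ?_
  rintro w ⟨g, hg⟩
  refine ⟨g, fun i => ?_⟩
  rw [← Polynomial.aeval_pi_apply₂ (fun i => lam (Fin.natAdd m i))]
  exact (congrFun hg i).symm
end

section
/- Let p ∈ ℤ[X] be a monic polynomial of degree n that is irreducible over ℚ and whose roots λ_1, …, λ_n are all real (and necessarily distinct), and let 1 ≤ m < n. If real numbers x_{m+1}, …, x_n satisfy Σ_{i=m+1}^{n} x_i · λ_i^{k−1} ∈ ℤ for every k = 1, …, n, then x_i = 0 for all i = m+1, …, n. -/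
open Polynomial in
/-- The elementary symmetric functions of the roots of a monic polynomial with coefficients in `A`
lie in the image of `A`. -/
theorem esymm_roots_mem_range {A B ι : Type*} [CommRing A] [CommRing B] [Fintype ι]
    (f : A →+* B) (p : A[X]) (lam : ι → B) (hp : p.map f = ∏ i, (X - C (lam i))) (j : ℕ) :
    (Finset.univ.val.map lam).esymm j ∈ f.range := by
  by_cases hj : j ≤ Fintype.card ι
  · have hcard : Multiset.card (Finset.univ.val.map lam) = Fintype.card ι := by simp
    have h := Multiset.prod_X_sub_C_coeff (Finset.univ.val.map lam)
      (k := Fintype.card ι - j) (by rw [hcard]; exact Nat.sub_le _ _)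
    rw [hcard, Nat.sub_sub_self hj, Multiset.map_map] at h
    change (∏ i, (X - C (lam i))).coeff _ = _ at h
    rw [← hp, coeff_map] at h
    refine ⟨(-1) ^ j * p.coeff (Fintype.card ι - j), ?_⟩
    rw [map_mul, h, map_pow, map_neg, map_one, ← mul_assoc, ← mul_pow]
    simp
  · rw [Multiset.esymm, Multiset.powersetCard_eq_empty _ (by simpa using hj)]
    simp

/-- The power sums of the roots of a monic polynomial with coefficients in `A` lie in the image
of `A`. -/
theorem sum_pow_roots_mem_range {A B ι : Type*} [CommRing A] [CommRing B] [Fintype ι]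
    (f : A →+* B) (p : Polynomial A) (lam : ι → B)
    (hp : p.map f = ∏ i, (Polynomial.X - Polynomial.C (lam i))) (j : ℕ) :
    ∑ i, lam i ^ j ∈ f.range := by
  classical
  induction j using Nat.strong_induction_on with
  | _ j ih =>
    rcases Nat.eq_zero_or_pos j with rfl | hj
    · simp
    · have h := congrArg (MvPolynomial.aeval lam) (MvPolynomial.psum_eq_mul_esymm_sub_sum ι B j hj)
      simp only [MvPolynomial.psum, map_sub, map_sum, map_mul, map_pow, map_neg, map_one,
        map_natCast, MvPolynomial.aeval_X, MvPolynomial.aeval_esymm_eq_multiset_esymm] at h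
      have hneg : ∀ a : ℕ, (-1 : B) ^ a ∈ f.range := fun a => pow_mem (neg_mem (one_mem _)) a
      rw [h]
      refine sub_mem (mul_mem (mul_mem (hneg _) (natCast_mem _ _))
        (esymm_roots_mem_range f p lam hp j)) (sum_mem fun a ha => ?_)
      simp only [Finset.mem_filter, Set.mem_Ioo] at ha
      have hsum := Finset.HasAntidiagonal.mem_antidiagonal.mp ha.1
      exact mul_mem (mul_mem (hneg _) (esymm_roots_mem_range f p lam hp _)) (ih _ (by lia))

open scoped Matrix in
/-- If `λ` is an enumeration of the distinct roots of a polynomial over `K`, then a vector `y` all of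
whose moments `∑ i, y i * λ i ^ j` lie in `K` is of the form `y i = ∑ j, w j * λ i ^ j` with
coefficients `w j` in `K`. -/
theorem exists_vandermonde_mulVec_eq {K L : Type*} [Field K] [Field L] (f : K →+* L) {n : ℕ}
    (p : Polynomial K) (lam : Fin n → L) (hinj : Function.Injective lam)
    (hp : p.map f = ∏ i, (Polynomial.X - Polynomial.C (lam i)))
    (y : Fin n → L) (z : Fin n → K) (hz : ∀ j : Fin n, ∑ i, y i * lam i ^ (j : ℕ) = f (z j)) :
    ∃ w : Fin n → K, Matrix.vandermonde lam *ᵥ (f ∘ w) = y := by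
  choose s hs using sum_pow_roots_mem_range f p lam hp
  let T : Matrix (Fin n) (Fin n) K := Matrix.of fun i j => s (i + j)
  have hT : T.map f = (Matrix.vandermonde lam)ᵀ * Matrix.vandermonde lam := by
    ext i j
    rw [Matrix.vandermonde_transpose_mul_vandermonde, ← hs]
    rfl
  have hV : (Matrix.vandermonde lam).det ≠ 0 := Matrix.det_vandermonde_ne_zero_iff.mpr hinj
  have hTdet : T.det ≠ 0 := by
    intro h
    have h' : (T.map f).det = 0 := by
      rw [← RingHom.mapMatrix_apply, ← RingHom.map_det, h, map_zero]
    rw [hT, Matrix.det_mul, Matrix.det_transpose] at h'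
    exact hV (mul_self_eq_zero.mp h')
  refine ⟨T⁻¹ *ᵥ z, ?_⟩
  apply Matrix.mulVec_injective_of_det_ne_zero
    (M := (Matrix.vandermonde lam)ᵀ) (by rwa [Matrix.det_transpose])
  rw [Matrix.mulVec_mulVec, ← hT]
  ext j
  rw [← RingHom.map_mulVec, Matrix.mulVec_mulVec, Matrix.mul_nonsing_inv _ hTdet.isUnit,
    Matrix.one_mulVec, ← hz]
  simp [Matrix.mulVec, dotProduct, Matrix.vandermonde_apply, mul_comm]


/-- injectivity criterion: for a monic irreducible integer polynomial of
degree `n = m + k` with all roots real and distinct and `1 ≤ m < n`, if real numbers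
`x_{m+1}, …, x_n` satisfy `Σ_{i=m+1}^n x_i λ_i^{j-1} ∈ ℤ` for every `j = 1, …, n`, then
all the `x_i` vanish. -/
theorem stmt_10 (m k : ℕ) (hm : 1 ≤ m) (hk : 1 ≤ k)
    (p : Polynomial ℤ) (hmonic : p.Monic) (hdeg : p.natDegree = m + k)
    (hirr : Irreducible (p.map (Int.castRingHom ℚ)))
    (lam : Fin (m + k) → ℝ) (hinj : Function.Injective lam)
    (hroots : p.map (Int.castRingHom ℝ) = ∏ i, (Polynomial.X - Polynomial.C (lam i)))
    (x : Fin k → ℝ)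
    (hint : ∀ j : Fin (m + k), ∃ z : ℤ,
      ∑ i : Fin k, x i * lam (Fin.natAdd m i) ^ (j : ℕ) = (z : ℝ)) :
    ∀ i, x i = 0 := by
  set q : Polynomial ℚ := p.map (Int.castRingHom ℚ) with hq
  have hqmonic : q.Monic := hmonic.map _
  have hqdeg : q.natDegree = m + k := by rw [hq, hmonic.natDegree_map, hdeg]
  have hqroots : q.map (algebraMap ℚ ℝ) = ∏ i, (Polynomial.X - Polynomial.C (lam i)) := by
    rw [← hroots, hq, Polynomial.map_map]
    congr 1
  choose z hz using hint
  obtain ⟨w, hw⟩ := exists_vandermonde_mulVec_eq (algebraMap ℚ ℝ) q lam hinj hqroots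
    (Fin.append 0 x) (fun j => (z j : ℚ)) (fun j => by simp [Fin.sum_univ_add, hz j])
  let i₀ : Fin (m + k) := Fin.castAdd k ⟨0, hm⟩
  have hroot : Polynomial.aeval (lam i₀) q = 0 := by
    rw [Polynomial.aeval_def, ← Polynomial.eval_map, hqroots, Polynomial.eval_prod]
    exact Finset.prod_eq_zero (Finset.mem_univ i₀) (by simp)
  have hmin : (minpoly ℚ (lam i₀)).natDegree = m + k := by
    rw [← minpoly.eq_of_irreducible_of_monic hirr hroot hqmonic, hqdeg]
  have hli := linearIndependent_pow (K := ℚ) (lam i₀)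
  rw [hmin, Fintype.linearIndependent_iff] at hli
  have hw0 : w = 0 := by
    funext j
    refine hli w ?_ j
    have h := congrFun hw i₀
    rw [Fin.append_left] at h
    simpa [Matrix.mulVec, dotProduct, Matrix.vandermonde_apply, Algebra.smul_def, mul_comm] using h
  intro i
  have h := congrFun hw (Fin.natAdd m i)
  rw [Fin.append_right, hw0] at h
  rw [← h]
  simp [Matrix.mulVec, dotProduct]
end

section
/- Let L̃ be a lattice in ℝ^d × ℝ^e (a discrete additive subgroup with compact quotient), let π_1 : ℝ^d × ℝ^e → ℝ^d and π_2 : ℝ^d × ℝ^e → ℝ^e be the canonical projections, and suppose π_1 restricted to L̃ is injective and π_2(L̃) is dense in ℝ^e. For W ⊆ ℝ^e define Λ(W) := {π_1(x) : x ∈ L̃, π_2(x) ∈ W}. If W is bounded, then Λ(W) − Λ(W) is uniformly discrete in ℝ^d; if moreover W has nonempty interior, then Λ(W) is relatively dense in ℝ^d. In particular, for W bounded with nonempty interior, Λ(W) is a Meyer set. -/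
open Pointwise

/-- The point set `Λ(W)` cut out from the lattice `Ltil` by the window `W` in a
cut-and-project scheme `ℝ^d × ℝ^e ⊇ Ltil`. -/
def cutProject {d e : ℕ}
    (Ltil : AddSubgroup (EuclideanSpace ℝ (Fin d) × EuclideanSpace ℝ (Fin e)))
    (W : Set (EuclideanSpace ℝ (Fin e))) : Set (EuclideanSpace ℝ (Fin d)) :=
  {x | ∃ p ∈ Ltil, p.2 ∈ W ∧ p.1 = x}

/-- A cocompact additive subgroup of a seminormed group is relatively dense. -/
theorem AddSubgroup.exists_forall_norm_sub_lt {E : Type*} [SeminormedAddCommGroup E]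
    (L : AddSubgroup E) [CompactSpace (E ⧸ L)] :
    ∃ R > (0 : ℝ), ∀ v : E, ∃ p ∈ L, ‖v - p‖ < R := by
  obtain ⟨t, ht⟩ := isCompact_univ.elim_finite_subcover
    (fun n : ℕ => ((↑) : E → E ⧸ L) '' Metric.ball 0 (n : ℝ))
    (fun n => QuotientAddGroup.isOpenMap_coe _ Metric.isOpen_ball) (by
      intro q _
      obtain ⟨v, rfl⟩ := QuotientAddGroup.mk_surjective q
      obtain ⟨n, hn⟩ := exists_nat_gt ‖v‖
      exact Set.mem_iUnion.2 ⟨n, v, by simpa using hn, rfl⟩)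
  refine ⟨(t.sup id : ℕ) + 1, by positivity, fun v => ?_⟩
  obtain ⟨n, hn, u, hu, huv⟩ := Set.mem_iUnion₂.1 (ht (Set.mem_univ (v : E ⧸ L)))
  refine ⟨-u + v, QuotientAddGroup.eq.1 huv, ?_⟩
  have hle : (n : ℝ) ≤ (t.sup id : ℕ) := by exact_mod_cast Finset.le_sup (f := id) hn
  have hu' : ‖u‖ < n := by simpa using hu
  have huv' : v - (-u + v) = u := by abel
  rw [huv']
  linarith

/-- The nonzero elements of a finite subset of a normed group are bounded away from zero. -/
theorem Set.Finite.exists_pos_le_norm {E : Type*} [NormedAddCommGroup E] {S : Set E}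
    (hS : S.Finite) : ∃ r > (0 : ℝ), ∀ x ∈ S, x ≠ 0 → r ≤ ‖x‖ := by
  obtain ⟨r, hr, h⟩ := Metric.isOpen_iff.1 (hS.subset Set.sdiff_subset).isClosed.isOpen_compl
    (0 : E) (show (0 : E) ∈ (S \ {0})ᶜ by simp)
  refine ⟨r, hr, fun x hx hx0 => not_lt.1 fun hlt => ?_⟩
  exact h (show x ∈ Metric.ball 0 r by simpa using hlt) ⟨hx, hx0⟩

/-- in a cut-and-project scheme, if the window `W` is bounded then
`Λ(W) - Λ(W)` is uniformly discrete; if moreover `W` has nonempty interior then `Λ(W)`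
is relatively dense; in particular `Λ(W)` is then a Meyer set. -/
theorem stmt_12 (d e : ℕ)
    (Ltil : AddSubgroup (EuclideanSpace ℝ (Fin d) × EuclideanSpace ℝ (Fin e)))
    (hdisc : DiscreteTopology Ltil)
    (hcpt : CompactSpace ((EuclideanSpace ℝ (Fin d) × EuclideanSpace ℝ (Fin e)) ⧸ Ltil))
    (hinj : Set.InjOn Prod.fst (Ltil : Set (EuclideanSpace ℝ (Fin d) × EuclideanSpace ℝ (Fin e))))
    (hdense : Dense (Prod.snd '' (Ltil : Set (EuclideanSpace ℝ (Fin d) × EuclideanSpace ℝ (Fin e)))))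
    (W : Set (EuclideanSpace ℝ (Fin e))) :
    (Bornology.IsBounded W →
      ∃ r > (0 : ℝ), ∀ x ∈ cutProject Ltil W - cutProject Ltil W,
        ∀ y ∈ cutProject Ltil W - cutProject Ltil W, x ≠ y → r ≤ ‖x - y‖) ∧
    (Bornology.IsBounded W → (interior W).Nonempty →
      ∃ R > (0 : ℝ), ∀ x : EuclideanSpace ℝ (Fin d), ∃ y ∈ cutProject Ltil W, ‖x - y‖ < R) := by
  refine ⟨fun hW => ?_, fun _ hW => ?_⟩
  · obtain ⟨M, hM⟩ := hW.exists_norm_le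
    have hfin : (Metric.closedBall 0 (max 1 (4 * M)) ∩ (Ltil : Set
        (EuclideanSpace ℝ (Fin d) × EuclideanSpace ℝ (Fin e)))).Finite :=
      Metric.finite_isBounded_inter_isClosed (isDiscrete_iff_discreteTopology.2 hdisc)
        Metric.isBounded_closedBall AddSubgroup.isClosed_of_discrete
    obtain ⟨r, hr, h⟩ := (hfin.image Prod.fst).exists_pos_le_norm
    refine ⟨min r 1, lt_min hr one_pos, ?_⟩
    rintro _ ⟨_, ⟨a, ha, haW, rfl⟩, _, ⟨b, hb, hbW, rfl⟩, rfl⟩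
      _ ⟨_, ⟨a', ha', haW', rfl⟩, _, ⟨b', hb', hbW', rfl⟩, rfl⟩ hne
    by_contra! hlt
    have hmem : a - b - (a' - b') ∈ Ltil :=
      Ltil.sub_mem (Ltil.sub_mem ha hb) (Ltil.sub_mem ha' hb')
    have hsnd : ‖(a - b - (a' - b')).2‖ ≤ 4 * M := by
      have h₁ := norm_sub_le (a.2 - b.2) (a'.2 - b'.2)
      have h₂ := norm_sub_le a.2 b.2
      have h₃ := norm_sub_le a'.2 b'.2
      have := hM _ haW
      have := hM _ hbW
      have := hM _ haW'
      have := hM _ hbW'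
      simp only [Prod.snd_sub]
      linarith
    have hfst : ‖(a - b - (a' - b')).1‖ ≤ 1 := (hlt.trans_le (min_le_right _ _)).le
    refine (hlt.trans_le (min_le_left _ _)).not_ge
      (h _ ⟨a - b - (a' - b'), ⟨?_, hmem⟩, rfl⟩ (sub_ne_zero.2 hne))
    rw [mem_closedBall_zero_iff, Prod.norm_def]
    exact max_le_max hfst hsnd
  · obtain ⟨w, hw⟩ := hW
    obtain ⟨ε, hε, hball⟩ := Metric.isOpen_iff.1 isOpen_interior w hw
    obtain ⟨R, hR, hcov⟩ := Ltil.exists_forall_norm_sub_lt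
    obtain ⟨t, ht⟩ := (isCompact_closedBall (0 : EuclideanSpace ℝ (Fin e)) R).elim_finite_subcover
      (fun l : Ltil => Metric.ball l.1.2 ε) (fun _ => Metric.isOpen_ball) (by
        intro y _
        obtain ⟨_, ⟨l, hl, rfl⟩, hy⟩ := hdense.exists_dist_lt y hε
        exact Set.mem_iUnion.2 ⟨⟨l, hl⟩, hy⟩)
    refine ⟨R + ∑ l ∈ t, ‖l.1.1‖, by positivity, fun x => ?_⟩
    obtain ⟨p, hp, hxp⟩ := hcov (x, w)
    have hxp₁ : ‖x - p.1‖ < R := (norm_fst_le ((x, w) - p)).trans_lt hxp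
    have hxp₂ : ‖w - p.2‖ < R := (norm_snd_le ((x, w) - p)).trans_lt hxp
    obtain ⟨l, hl, hwl⟩ := Set.mem_iUnion₂.1 (ht (mem_closedBall_zero_iff.2 hxp₂.le))
    refine ⟨(p + l.1).1, ⟨p + l.1, Ltil.add_mem hp l.2, interior_subset (hball ?_), rfl⟩, ?_⟩
    · rw [Metric.mem_ball', dist_eq_norm, Prod.snd_add, ← sub_sub]
      rwa [Metric.mem_ball, dist_eq_norm] at hwl
    · have hle : ‖l.1.1‖ ≤ ∑ l ∈ t, ‖l.1.1‖ :=
        Finset.single_le_sum (f := fun l : Ltil => ‖l.1.1‖) (fun _ _ => norm_nonneg _) hl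
      rw [Prod.fst_add, ← sub_sub]
      linarith [norm_sub_le (x - p.1) l.1.1]
end

section
/- Let p ∈ ℤ[X] be a monic polynomial of degree n ≥ 2 that is irreducible over ℚ and whose roots λ_1, …, λ_n are all real (and necessarily distinct), and let 1 ≤ m < n. For δ > 0 define E_δ := {(g(λ_1), …, g(λ_m)) : g ∈ ℤ[X] with (Σ_{i=m+1}^{n} g(λ_i)^2)^{1/2} < δ} ⊆ ℝ^m. Then for every δ > 0 the set E_δ is a Meyer set in ℝ^m. -/
open Pointwise

open Polynomial

/-- Integer polynomials approximate arbitrary prescribed real values at distinct real nodes,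
up to a uniform error. -/
theorem exists_int_polynomial_aeval_approx {ι : Type*} [Fintype ι] (lam : ι → ℝ)
    (hinj : Function.Injective lam) :
    ∃ R > (0 : ℝ), ∀ z : ι → ℝ, ∃ g : ℤ[X], ∀ i, |aeval (lam i) g - z i| ≤ R := by
  classical
  set n := Fintype.card ι
  have hnonneg : ∀ i, 0 ≤ ∑ j ∈ Finset.range n, |lam i| ^ j := fun i => by positivity
  refine ⟨∑ i, ∑ j ∈ Finset.range n, |lam i| ^ j + 1,
    add_pos_of_nonneg_of_pos (Finset.sum_nonneg fun i _ => hnonneg i) one_pos, fun z => ?_⟩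
  set f := Lagrange.interpolate Finset.univ lam z
  have hf : ∀ i, z i = ∑ j ∈ Finset.range n, f.coeff j * lam i ^ j := fun i => by
    rw [← Lagrange.eval_interpolate_at_node z hinj.injOn (Finset.mem_univ i)]
    by_cases h0 : f = 0
    · simp [f, h0]
    · refine eval_eq_sum_range' ?_ _
      rw [natDegree_lt_iff_degree_lt h0]
      exact Lagrange.degree_interpolate_lt z hinj.injOn
  refine ⟨∑ j ∈ Finset.range n, monomial j ⌊f.coeff j⌋, fun i => ?_⟩
  have hsub : aeval (lam i) (∑ j ∈ Finset.range n, monomial j ⌊f.coeff j⌋) - z i =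
      ∑ j ∈ Finset.range n, -Int.fract (f.coeff j) * lam i ^ j := by
    rw [hf i, map_sum, ← Finset.sum_sub_distrib]
    refine Finset.sum_congr rfl fun j _ => ?_
    rw [aeval_monomial, Int.fract]
    simp only [algebraMap_int_eq, eq_intCast]
    ring
  rw [hsub]
  calc _ ≤ ∑ j ∈ Finset.range n, |(-Int.fract (f.coeff j) * lam i ^ j)| :=
        Finset.abs_sum_le_sum_abs _ _
    _ ≤ ∑ j ∈ Finset.range n, |lam i| ^ j := by
        refine Finset.sum_le_sum fun j _ => ?_
        rw [abs_mul, abs_neg, abs_pow, abs_of_nonneg (Int.fract_nonneg _)]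
        exact mul_le_of_le_one_left (by positivity) (Int.fract_lt_one _).le
    _ ≤ ∑ i, ∑ j ∈ Finset.range n, |lam i| ^ j :=
        Finset.single_le_sum (f := fun i => ∑ j ∈ Finset.range n, |lam i| ^ j)
          (fun i _ => hnonneg i) (Finset.mem_univ i)
    _ ≤ _ := by linarith

/-- There is an integer polynomial not vanishing at one chosen node and arbitrarily small
at all the others. -/
theorem exists_int_polynomial_aeval_small {ι : Type*} [Fintype ι] (lam : ι → ℝ)
    (hinj : Function.Injective lam) (i₀ : ι) {ε : ℝ} (hε : 0 < ε) :
    ∃ h : ℤ[X], aeval (lam i₀) h ≠ 0 ∧ ∀ i ≠ i₀, |aeval (lam i) h| < ε := by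
  classical
  obtain ⟨R, hR, happrox⟩ := exists_int_polynomial_aeval_approx lam hinj
  choose g hg using fun t : ℕ => happrox (Pi.single i₀ (t * (2 * R + 1)))
  set x : ℕ → ι → ℝ := fun t i => if i = i₀ then 0 else aeval (lam i) (g t)
  have hx : ∀ t, x t ∈ Metric.closedBall (0 : ι → ℝ) R := fun t => by
    rw [mem_closedBall_zero_iff, pi_norm_le_iff_of_nonneg hR.le]
    intro i
    by_cases hi : i = i₀
    · simp [x, hi, hR.le]
    · simpa [x, hi] using hg t i
  obtain ⟨a, -, φ, hφ, hlim⟩ := tendsto_subseq_of_bounded Metric.isBounded_closedBall hx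
  obtain ⟨N, hN⟩ := Metric.cauchySeq_iff.1 hlim.cauchySeq ε hε
  have hdist := hN (N + 1) (Nat.le_succ N) N le_rfl
  have hlt : (φ N : ℝ) + 1 ≤ φ (N + 1) := by exact_mod_cast hφ (Nat.lt_succ_self N)
  refine ⟨g (φ (N + 1)) - g (φ N), fun h0 => ?_, fun i hi => ?_⟩
  · have h1 := abs_le.1 (hg (φ (N + 1)) i₀)
    have h2 := abs_le.1 (hg (φ N) i₀)
    simp only [Pi.single_eq_same] at h1 h2
    rw [map_sub] at h0
    nlinarith [h1.1, h1.2, h2.1, h2.2]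
  · have := (dist_pi_lt_iff hε).1 hdist i
    simpa [x, hi, Real.dist_eq] using this

/-- An integer polynomial vanishing at one root of an irreducible polynomial vanishes at
all of its roots. -/
theorem aeval_eq_zero_of_irreducible_of_aeval_eq_zero {p : ℤ[X]} (hmonic : p.Monic)
    (hirr : Irreducible (p.map (Int.castRingHom ℚ))) {a b : ℝ} (ha : aeval a p = 0)
    (hb : aeval b p = 0) {g : ℤ[X]} (hg : aeval a g = 0) : aeval b g = 0 := by
  have haeval : ∀ (c : ℝ) (q : ℤ[X]), aeval c (q.map (Int.castRingHom ℚ)) = aeval c q :=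
    fun c q => aeval_map_algebraMap ℚ c q
  have hmin := minpoly.eq_of_irreducible_of_monic hirr ((haeval a p).trans ha) (hmonic.map _)
  have hdvd := minpoly.dvd ℚ a ((haeval a g).trans hg)
  rw [← hmin] at hdvd
  rw [← haeval]
  exact aeval_eq_zero_of_dvd_aeval_eq_zero hdvd ((haeval b p).trans hb)

/-- The product of the values of an integer polynomial over the roots of a monic integer
polynomial is an integer. -/
theorem exists_int_eq_prod_aeval_roots {ι : Type*} [Fintype ι] {p : ℤ[X]} {lam : ι → ℝ}
    (hroots : p.map (Int.castRingHom ℝ) = ∏ i, (X - C (lam i))) (g : ℤ[X]) :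
    ∃ N : ℤ, (N : ℝ) = ∏ i, aeval (lam i) g := by
  have hmonic : (∏ i, (X - C (lam i))).Monic := monic_prod_of_monic _ _ fun i _ => monic_X_sub_C _
  have hsplit : (∏ i, (X - C (lam i))).Splits := Splits.prod fun i _ => Splits.X_sub_C _
  have hres := resultant_eq_prod_eval (∏ i, (X - C (lam i))) (g.map (Int.castRingHom ℝ))
    g.natDegree natDegree_map_le hsplit
  rw [hmonic.leadingCoeff, one_pow, one_mul, roots_prod _ _ hmonic.ne_zero] at hres
  rw [← hroots, resultant_map_map] at hres
  refine ⟨_, hres.trans ?_⟩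
  simp [Multiset.map_map, Multiset.bind_singleton, eval_map, aeval_def]

/-- in the totally real cut-and-project scheme attached to a monic
irreducible integer polynomial of degree `n = m + k ≥ 2` with all roots real and
distinct, the projected set
`E_δ = {(g(λ_1), …, g(λ_m)) : g ∈ ℤ[X], (Σ_{i>m} g(λ_i)^2)^{1/2} < δ}`
is a Meyer set in `ℝ^m` (relatively dense with uniformly discrete difference set)
for every `δ > 0`. -/
theorem stmt_13 (m k : ℕ) (hm : 1 ≤ m) (hk : 1 ≤ k)
    (p : Polynomial ℤ) (hmonic : p.Monic) (hdeg : p.natDegree = m + k)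
    (hirr : Irreducible (p.map (Int.castRingHom ℚ)))
    (lam : Fin (m + k) → ℝ) (hinj : Function.Injective lam)
    (hroots : p.map (Int.castRingHom ℝ) = ∏ i, (Polynomial.X - Polynomial.C (lam i)))
    (δ : ℝ) (hδ : 0 < δ)
    (Eδ : Set (EuclideanSpace ℝ (Fin m)))
    (hEδ : Eδ = {w | ∃ g : Polynomial ℤ,
      (∀ i : Fin m, w i = Polynomial.aeval (lam (Fin.castAdd k i)) g) ∧
      Real.sqrt (∑ i : Fin k, (Polynomial.aeval (lam (Fin.natAdd m i)) g) ^ 2) < δ}) :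
    (∃ R > (0 : ℝ), ∀ x : EuclideanSpace ℝ (Fin m), ∃ y ∈ Eδ, ‖x - y‖ < R) ∧
    (∃ r > (0 : ℝ), ∀ x ∈ Eδ - Eδ, ∀ y ∈ Eδ - Eδ, x ≠ y → r ≤ ‖x - y‖) := by
  have hroot : ∀ i, aeval (lam i) p = 0 := fun i => by
    have h : aeval (lam i) p = (p.map (Int.castRingHom ℝ)).eval (lam i) := by
      rw [eval_map, aeval_def, algebraMap_int_eq]
    rw [h, hroots, eval_prod]
    exact Finset.prod_eq_zero (Finset.mem_univ i) (by simp)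
  have hne : ∀ (g : ℤ[X]) (i j), aeval (lam i) g ≠ 0 → aeval (lam j) g ≠ 0 := fun g i j hi hj =>
    hi (aeval_eq_zero_of_irreducible_of_aeval_eq_zero hmonic hirr (hroot j) (hroot i) hj)
  subst hEδ
  constructor
  · obtain ⟨R, hR, happrox⟩ := exists_int_polynomial_aeval_approx lam hinj
    set η : ℝ := δ / (k + 1)
    have hη : 0 < η := by positivity
    obtain ⟨h, h0, hsmall⟩ := exists_int_polynomial_aeval_small lam hinj
      (Fin.castAdd k ⟨0, hm⟩) (div_pos hη hR)
    set B : ℝ := √(∑ i : Fin m, (|aeval (lam (Fin.castAdd k i)) h| * R) ^ 2)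
    refine ⟨B + 1, by positivity, fun x => ?_⟩
    obtain ⟨g, hg⟩ := happrox
      (Fin.append (fun i : Fin m => x i / aeval (lam (Fin.castAdd k i)) h) fun _ => 0)
    refine ⟨WithLp.toLp 2 fun i => aeval (lam (Fin.castAdd k i)) (h * g),
      ⟨h * g, fun i => rfl, ?_⟩, ?_⟩
    · rw [Real.sqrt_lt' hδ]
      calc _ ≤ ∑ _i : Fin k, η ^ 2 := by
            refine Finset.sum_le_sum fun i _ => sq_le_sq.2 ?_
            have h1 := hg (Fin.natAdd m i)
            rw [Fin.append_right, sub_zero] at h1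
            have h2 := hsmall (Fin.natAdd m i) (by simp [Fin.ext_iff]; omega)
            rw [map_mul, abs_mul, abs_of_pos hη]
            calc _ ≤ η / R * R := mul_le_mul h2.le h1 (abs_nonneg _) (by positivity)
              _ = η := div_mul_cancel₀ _ hR.ne'
        _ = k * η ^ 2 := by simp
        _ < (k + 1) ^ 2 * η ^ 2 := by
            have : (0 : ℝ) ≤ k := k.cast_nonneg
            gcongr
            nlinarith
        _ = δ ^ 2 := by
            rw [← mul_pow, mul_div_cancel₀ _ (by positivity)]
    · refine lt_of_le_of_lt ?_ (lt_add_one B)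
      rw [EuclideanSpace.norm_eq]
      refine Real.sqrt_le_sqrt (Finset.sum_le_sum fun i _ => ?_)
      refine pow_le_pow_left₀ (norm_nonneg _) ?_ 2
      have h1 := hg (Fin.castAdd k i)
      rw [Fin.append_left] at h1
      have hi : aeval (lam (Fin.castAdd k i)) h ≠ 0 := hne h _ _ h0
      have heq : (x - WithLp.toLp 2 fun i => aeval (lam (Fin.castAdd k i)) (h * g)) i =
          -(aeval (lam (Fin.castAdd k i)) h *
            (aeval (lam (Fin.castAdd k i)) g - x i / aeval (lam (Fin.castAdd k i)) h)) := by
        simp only [PiLp.sub_apply, map_mul]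
        field_simp
        ring
      rw [heq, norm_neg, Real.norm_eq_abs, abs_mul]
      gcongr
  · have hbound : ∀ g : ℤ[X], √(∑ i : Fin k, aeval (lam (Fin.natAdd m i)) g ^ 2) < δ →
        ∀ i : Fin k, |aeval (lam (Fin.natAdd m i)) g| ≤ δ := fun g hg i => by
      rw [← Real.sqrt_sq_eq_abs]
      exact (Real.sqrt_le_sqrt (Finset.single_le_sum
        (f := fun i : Fin k => aeval (lam (Fin.natAdd m i)) g ^ 2)
        (fun i _ => sq_nonneg _) (Finset.mem_univ i))).trans hg.le
    refine ⟨min 1 ((4 * δ) ^ k)⁻¹, by positivity, ?_⟩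
    rintro _ ⟨w₁, ⟨g₁, hw₁, hg₁⟩, w₂, ⟨g₂, hw₂, hg₂⟩, rfl⟩
      _ ⟨w₃, ⟨g₃, hw₃, hg₃⟩, w₄, ⟨g₄, hw₄, hg₄⟩, rfl⟩ hxy
    simp only at hxy ⊢
    set v := w₁ - w₂ - (w₃ - w₄)
    set g := g₁ - g₂ - (g₃ - g₄)
    have hv : ∀ i, v i = aeval (lam (Fin.castAdd k i)) g := fun i => by
      simp only [v, g, PiLp.sub_apply, map_sub, hw₁, hw₂, hw₃, hw₄]
    obtain ⟨i₀, hi₀⟩ : ∃ i, v i ≠ 0 := by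
      by_contra! hzero
      exact sub_ne_zero.2 hxy (PiLp.ext hzero)
    rw [hv] at hi₀
    obtain ⟨N, hN⟩ := exists_int_eq_prod_aeval_roots hroots g
    have hN0 : N ≠ 0 := by
      rintro rfl
      rw [Int.cast_zero] at hN
      exact Finset.prod_ne_zero_iff.2 (fun i _ => hne g _ i hi₀) hN.symm
    have hone : (1 : ℝ) ≤ ∏ i, |aeval (lam i) g| := by
      rw [← Finset.abs_prod, ← hN]
      exact_mod_cast Int.one_le_abs hN0
    have hint : ∀ i : Fin k, |aeval (lam (Fin.natAdd m i)) g| ≤ 4 * δ := fun i => by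
      have h1 := abs_le.1 (hbound g₁ hg₁ i)
      have h2 := abs_le.1 (hbound g₂ hg₂ i)
      have h3 := abs_le.1 (hbound g₃ hg₃ i)
      have h4 := abs_le.1 (hbound g₄ hg₄ i)
      simp only [g, map_sub]
      rw [abs_le]
      constructor <;> linarith [h1.1, h1.2, h2.1, h2.2, h3.1, h3.2, h4.1, h4.2]
    have hphys : ∀ i : Fin m, |aeval (lam (Fin.castAdd k i)) g| ≤ ‖v‖ := fun i => by
      rw [← hv]
      exact PiLp.norm_apply_le v i
    have hprod : (1 : ℝ) ≤ ‖v‖ ^ m * (4 * δ) ^ k := by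
      rw [Fin.prod_univ_add] at hone
      refine hone.trans (mul_le_mul ?_ ?_ (by positivity) (by positivity))
      · exact (Finset.prod_le_prod (fun i _ => abs_nonneg _) fun i _ => hphys i).trans_eq (by simp)
      · exact (Finset.prod_le_prod (fun i _ => abs_nonneg _) fun i _ => hint i).trans_eq (by simp)
    rcases le_total 1 ‖v‖ with h1 | h1
    · exact (min_le_left _ _).trans h1
    · refine (min_le_right _ _).trans ?_
      rw [inv_le_iff_one_le_mul₀ (by positivity)]
      refine hprod.trans ?_
      gcongr
      exact pow_le_of_le_one (norm_nonneg _) h1 (by omega)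
end

section
/- Let φ : ℝ^d → ℝ^d be a linear map for which there exists q ∈ ℤ[X] with φ ∘ q(φ) = id (so φ is invertible and φ⁻¹ = q(φ) ∈ ℤ[φ]). Let C_1, …, C_κ be subsets of ℝ^d, let j ∈ {1, …, κ} with 0 ∈ C_j, and suppose φ(C_i) ⊆ C_j for every i = 1, …, κ. Then the additive subgroup of ℝ^d generated by ⋃_{i≤κ} C_i equals the additive subgroup generated by Ξ := ⋃_{i≤κ} (C_i − C_i). -/
open Pointwise

/-- An additive subgroup invariant under `φ` is invariant under every integer polynomial in `φ`. -/
theorem AddSubgroup.aeval_apply_mem {R M : Type*} [CommRing R] [AddCommGroup M] [Module R M]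
    {H : AddSubgroup M} {φ : Module.End R M} (hφ : ∀ x ∈ H, φ x ∈ H) (p : Polynomial ℤ)
    {x : M} (hx : x ∈ H) : Polynomial.aeval φ p x ∈ H := by
  induction p using Polynomial.induction_on' with
  | add p r hp hr =>
    rw [map_add, LinearMap.add_apply]
    exact H.add_mem hp hr
  | monomial n a =>
    have hpow : (φ ^ n) x ∈ H := by
      induction n with
      | zero => simpa using hx
      | succ n ih =>
        rw [pow_succ', Module.End.mul_apply]
        exact hφ _ ih
    rw [← Polynomial.C_mul_X_pow_eq_monomial]
    simpa using H.zsmul_mem hpow a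

/-- identity (7) of the paper: if `φ⁻¹ = q(φ) ∈ ℤ[φ]`, `0 ∈ C_j` and
`φ(C_i) ⊆ C_j` for all `i`, then the subgroup generated by `⋃ C_i` equals the subgroup
generated by `Ξ = ⋃ (C_i - C_i)`. -/
theorem stmt_14 (d κ : ℕ)
    (φ : Module.End ℝ (EuclideanSpace ℝ (Fin d)))
    (q : Polynomial ℤ) (hq : φ * Polynomial.aeval φ q = 1)
    (C : Fin κ → Set (EuclideanSpace ℝ (Fin d)))
    (j : Fin κ) (h0 : (0 : EuclideanSpace ℝ (Fin d)) ∈ C j)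
    (hφC : ∀ i, ⇑φ '' C i ⊆ C j) :
    AddSubgroup.closure (⋃ i, C i) = AddSubgroup.closure (⋃ i, (C i - C i)) := by
  set G := AddSubgroup.closure (⋃ i, C i)
  set H := AddSubgroup.closure (⋃ i, (C i - C i))
  have hHG : H ≤ G := by
    refine (AddSubgroup.closure_le _).2 (Set.iUnion_subset fun i => ?_)
    rintro _ ⟨a, ha, b, hb, rfl⟩
    exact G.sub_mem (AddSubgroup.subset_closure (Set.mem_iUnion_of_mem i ha))
      (AddSubgroup.subset_closure (Set.mem_iUnion_of_mem i hb))
  have hCj : ∀ x ∈ C j, x ∈ H := fun x hx =>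
    AddSubgroup.subset_closure (Set.mem_iUnion_of_mem j ⟨x, hx, 0, h0, sub_zero x⟩)
  have hφG : G ≤ H.comap φ.toAddMonoidHom :=
    (AddSubgroup.closure_le _).2 <| Set.iUnion_subset fun i x hx =>
      hCj _ (hφC i (Set.mem_image_of_mem φ hx))
  refine le_antisymm (fun x hx => ?_) hHG
  have hcomm : Polynomial.aeval φ q * φ = 1 := by
    rw [← hq]
    simpa using congrArg (Polynomial.aeval φ) (mul_comm q Polynomial.X)
  have hx' : Polynomial.aeval φ q (φ x) = x := LinearMap.congr_fun hcomm x
  rw [← hx']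
  exact AddSubgroup.aeval_apply_mem (H := H) (x := φ x) (fun y hy => hφG (hHG hy)) q (hφG hx)
end

section
/- Let γ = 2 − √2, A = [0, 1 + √2] and B = [√2, 2 + √2], as subsets of ℝ. Then A = γA ∪ (γA + 1) ∪ γB ∪ (γB + (1 − √2)) and B = (γA + 2) ∪ (γB + 1) ∪ (γB + (2 − √2)), where γS = {γs : s ∈ S} and S + t = {s + t : s ∈ S}. Moreover A ∩ B = [√2, 1 + √2], which has nonempty interior. -/
/-- Example 6.1: with `γ = 2 - √2`, `A = [0, 1 + √2]` and
`B = [√2, 2 + √2]`, the intervals `A` and `B` satisfy the Galois-conjugated iterated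
function system equations of the substitution `a → aab`, `b → abab`, and their overlap
`A ∩ B = [√2, 1 + √2]` has nonempty interior. -/
theorem stmt_17 (γ : ℝ) (hγ : γ = 2 - Real.sqrt 2)
    (A B : Set ℝ)
    (hA : A = Set.Icc 0 (1 + Real.sqrt 2))
    (hB : B = Set.Icc (Real.sqrt 2) (2 + Real.sqrt 2)) :
    A = (fun x => γ * x) '' A ∪ (fun x => γ * x + 1) '' A ∪
        (fun x => γ * x) '' B ∪ (fun x => γ * x + (1 - Real.sqrt 2)) '' B ∧
    B = (fun x => γ * x + 2) '' A ∪ (fun x => γ * x + 1) '' B ∪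
        (fun x => γ * x + (2 - Real.sqrt 2)) '' B ∧
    A ∩ B = Set.Icc (Real.sqrt 2) (1 + Real.sqrt 2) ∧
    (interior (A ∩ B)).Nonempty := by
  have h_sq : Real.sqrt 2 * Real.sqrt 2 = 2 := Real.mul_self_sqrt zero_le_two
  have h_lo : 1.4 < Real.sqrt 2 := Real.lt_sqrt_of_sq_lt (by norm_num)
  have h_hi : Real.sqrt 2 < 1.5 := (Real.sqrt_lt' (by norm_num)).2 (by norm_num)
  have h_pos : 0 < γ := by linarith
  have h_zero : γ * 0 = 0 := mul_zero γ
  have h_A : γ * (1 + Real.sqrt 2) = Real.sqrt 2 := by rw [hγ]; linarith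
  have h_B_left : γ * Real.sqrt 2 = 2 * Real.sqrt 2 - 2 := by rw [hγ]; linarith
  have h_B_right : γ * (2 + Real.sqrt 2) = 2 := by rw [hγ]; linarith
  have h_inter : A ∩ B = Set.Icc (Real.sqrt 2) (1 + Real.sqrt 2) := by
    rw [hA, hB, Set.Icc_inter_Icc, max_eq_right (by linarith), min_eq_left (by linarith)]
  refine ⟨?_, ?_, h_inter, ?_⟩
  · rw [hA, hB, Set.image_mul_left_Icc' h_pos, Set.image_mul_left_Icc' h_pos,
      Set.image_affine_Icc' h_pos, Set.image_affine_Icc' h_pos, h_zero, h_A, h_B_left, h_B_right]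
    ext x
    simp only [Set.mem_union, Set.mem_Icc]
    grind
  · rw [hA, hB, Set.image_affine_Icc' h_pos, Set.image_affine_Icc' h_pos,
      Set.image_affine_Icc' h_pos, h_zero, h_A, h_B_left, h_B_right]
    ext x
    simp only [Set.mem_union, Set.mem_Icc]
    grind
  · rw [h_inter, interior_Icc]
    exact Set.nonempty_Ioo.2 (by linarith)
end
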